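/- arXiv:1504.07498 — 6 statements merged into one kernel-verified Lean document; each statement's English description precedes it below -/
import Mathlib

section
/- For complex numbers α, β, γ, δ, the equality (−α³ − β² + δ)² = 4·α·(α·β − γ)² holds if and only if there exist complex numbers A, B, C with α = (25/36)·A², β = (1/2)·(−(125/108)·A³ + (5/4)·B), γ = (1/32)·C, and δ = (25/64)·B² − (5/96)·A·C. (In other words, a point of the weighted projective space P(2:3:5:6) satisfies the modular equation for discriminant 5 exactly when it lies in the image of the embedding Ψ₅ of P(1:3:5) given by these formulas.) -/
/-- A point of the weighted projective space P(2:3:5:6) satisfies the modular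
equation for discriminant 5 exactly when it lies in the image of the embedding
Ψ₅ of P(1:3:5). -/
theorem modular_eq_disc5_iff_image_Psi5 (α β γ δ : ℂ) :
    (-α^3 - β^2 + δ)^2 = 4 * α * (α * β - γ)^2 ↔
    ∃ A B C : ℂ,
      α = (25/36) * A^2 ∧
      β = (1/2) * (-(125/108) * A^3 + (5/4) * B) ∧
      γ = (1/32) * C ∧
      δ = (25/64) * B^2 - (5/96) * A * C := by
  constructor
  · intro h
    have key : ∃ s : ℂ, s^2 = α ∧ -α^3 - β^2 + δ = 2 * s * (α * β - γ) := by
      obtain ⟨s, hs⟩ := IsAlgClosed.exists_pow_nat_eq α (n := 2) (by norm_num)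
      have h2 : (-α^3 - β^2 + δ)^2 = (2 * s * (α * β - γ))^2 := by
        rw [h, ← hs]; ring
      rcases sq_eq_sq_iff_eq_or_eq_neg.mp h2 with h3 | h3
      · exact ⟨s, hs, h3⟩
      · exact ⟨-s, by rw [neg_sq, hs], by rw [h3]; ring⟩
    obtain ⟨s, hs, hD⟩ := key
    subst hs
    refine ⟨6/5*s, 8/5*(β+s^3), 32*γ, by ring, by ring, by ring, ?_⟩
    linear_combination hD
  · rintro ⟨A, B, C, rfl, rfl, rfl, rfl⟩
    ring
end

section
/- Let A, B, C, r, s, q be complex numbers satisfying the four equations (25/36)A² = (4/9)(q² + 4qr + 4r² + 9rs), (1/2)(−(125/108)A³ + (5/4)B) = (1/27)(16(−2q + 8r + 3s)(q² + 4qr + 4r² + 9rs) − 12(−2q³ + 4q²r + 40qr² + 48r³ + 4q²s − 35qrs + 94r²s + 36rs²)), (1/32)C = −64r³s², and (25/64)B² − (5/96)AC = (64/3)r³s²(−2q + 8r + 3s). Then (A⁵ − 5A²B + C) · (3125A⁵ − 3375A²B + 243C) · (38400000000000A⁹B² + 120528000000000A⁶B³ − 4100625000000A³B⁴ − 184528125000000B⁵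 + 2560000000000A¹⁰C + 6998400000000A⁷BC + 34698942000000A⁴B²C + 42539883750000AB³C + 2576431800000A⁵C² + 2714325066000A²BC² + 146211169851C³) = 0. -/
/-- The pull-back under Ψ₅ of the intersection of the Humbert surfaces of
discriminant 5 and 8 is contained in the zero set of the product polynomial
generating the elimination ideal. -/
theorem pullback_H5_H8 (A B C r s q : ℂ)
    (h1 : (25/36) * A^2 = (4/9) * (q^2 + 4*q*r + 4*r^2 + 9*r*s))
    (h2 : (1/2) * (-(125/108) * A^3 + (5/4) * B) =
      (1/27) * (16 * (-2*q + 8*r + 3*s) * (q^2 + 4*q*r + 4*r^2 + 9*r*s)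
        - 12 * (-2*q^3 + 4*q^2*r + 40*q*r^2 + 48*r^3 + 4*q^2*s - 35*q*r*s
            + 94*r^2*s + 36*r*s^2)))
    (h3 : (1/32) * C = -64 * r^3 * s^2)
    (h4 : (25/64) * B^2 - (5/96) * A * C = (64/3) * r^3 * s^2 * (-2*q + 8*r + 3*s)) :
    (A^5 - 5*A^2*B + C)
    * (3125*A^5 - 3375*A^2*B + 243*C)
    * (38400000000000*A^9*B^2 + 120528000000000*A^6*B^3
        - 4100625000000*A^3*B^4 - 184528125000000*B^5
        + 2560000000000*A^10*C + 6998400000000*A^7*B*C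
        + 34698942000000*A^4*B^2*C + 42539883750000*A*B^3*C
        + 2576431800000*A^5*C^2 + 2714325066000*A^2*B*C^2
        + 146211169851*C^3) = 0 := by
  obtain ⟨u, hu⟩ : ∃ u, u = 5/4*A - (q + 2*r) := ⟨_, rfl⟩
  obtain ⟨v, hv⟩ : ∃ v, v = 5/4*A + (q + 2*r) := ⟨_, rfl⟩
  have hA : A = 2/5*(u+v) := by rw [hu, hv]; ring
  have hq : q = (v-u)/2 - 2*r := by rw [hu, hv]; ring
  have huv : r*s = u*v/9 := by
    rw [hu, hv]; linear_combination (-1/4)*h1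
  clear hu hv h1
  subst hq
  have hB : B = 64/45*u*v^2 - 16/15*u^2*v + 16/135*u^3 - 128/45*r*u*v := by
    rw [hA] at h2
    linear_combination (8/5)*h2 + (8/5)*(6*(v-u) - 16*r)*huv
  have hC : C = -2048/81*r*u^2*v^2 := by
    linear_combination 32*h3 - 2048*r*(r*s + u*v/9)*huv
  have hF : u^2*((u-9*v)*((u-v)*((u-4*v)^2-48*r*v))) = 0 := by
    have e : r^3 * s^2 * (-2*((v-u)/2 - 2*r) + 8*r + 3*s)
        = r*(u*v/9)^2*(u-v+12*r) + 3*(u*v/9)^3 := by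
      rw [← huv]; ring
    rw [hC, hB, hA] at h4
    linear_combination (729/4)*h4 + (729/4)*(64/3)*e
  clear h2 h3 h4 huv
  rcases mul_eq_zero.1 hF with h | hF
  · have hu : u = 0 := by simpa using h
    subst hu
    rw [hC, hB]; ring
  rcases mul_eq_zero.1 hF with h | hF
  · have hu : u = 9*v := by linear_combination h
    have h0 : A^5 - 5*A^2*B + C = 0 := by
      rw [hC, hB, hA, hu]; ring
    rw [h0]; ring
  rcases mul_eq_zero.1 hF with h | hF
  · have hu : u = v := by linear_combination h
    have h0 : 3125*A^5 - 3375*A^2*B + 243*C = 0 := by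
      rw [hC, hB, hA, hu]; ring
    rw [h0]; ring
  · have hB' : B = 64/45*u*v^2 - 16/15*u^2*v + 16/135*u^3 - 8/135*u*(u-4*v)^2 := by
      linear_combination hB + 8/135*u*hF
    have hC' : C = -128/243*u^2*v*(u-4*v)^2 := by
      linear_combination hC + 128/243*u^2*v*hF
    apply mul_eq_zero_of_right
    rw [hC', hB', hA]; ring
end

section
/- Let A, B, C, q₁, r₁, s₁ be complex numbers satisfying the four equations (25/36)A² = (1/9)(q₁⁴ + 54q₁²s₁ + 24q₁r₁s₁ + 9s₁²), (1/2)(−(125/108)A³ + (5/4)B) = (1/27)(q₁⁶ − 135q₁⁴s₁ − 72q₁³r₁s₁ − 405q₁²s₁² − 243q₁r₁s₁² − 27r₁²s₁²), (1/32)C = −r₁²s₁⁴, and (25/64)B² − (5/96)AC = (1/3)s₁⁴(q₁²r₁² + 6q₁r₁³ + 3r₁⁴ + 6q₁r₁s₁ + 3s₁²). Then q₁·(2q₁ + r₁)·s₁²·(q₁³ − q₁s₁ − r₁s₁)·(2q₁⁴ + q₁³r₁ − 11q₁²s₁ − 22q₁r₁s₁ − 8r₁²s₁ + 9s₁²)·(2q₁⁴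 − 27q₁²s₁ − 27q₁r₁s₁ + 81s₁²)·(q₁⁶ − 20q₁⁴s₁ − 9q₁³r₁s₁ + 98q₁²s₁² + 62q₁r₁s₁² + 8r₁²s₁² + 9s₁³) = 0. -/
/-- The common zero set of the four differences defining the pull-back under Ψ₅
of the intersection of the Humbert surfaces of discriminant 5 and 21 is
contained in the zero set of the generator of the elimination ideal
I₂₁ ∩ ℂ[q₁,r₁,s₁]. -/
theorem pullback_H5_H21_elimination (A B C q₁ r₁ s₁ : ℂ)
    (h1 : (25/36) * A^2 = (1/9) * (q₁^4 + 54*q₁^2*s₁ + 24*q₁*r₁*s₁ + 9*s₁^2))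
    (h2 : (1/2) * (-(125/108) * A^3 + (5/4) * B) =
      (1/27) * (q₁^6 - 135*q₁^4*s₁ - 72*q₁^3*r₁*s₁ - 405*q₁^2*s₁^2
        - 243*q₁*r₁*s₁^2 - 27*r₁^2*s₁^2))
    (h3 : (1/32) * C = -r₁^2 * s₁^4)
    (h4 : (25/64) * B^2 - (5/96) * A * C =
      (1/3) * s₁^4 * (q₁^2*r₁^2 + 6*q₁*r₁^3 + 3*r₁^4 + 6*q₁*r₁*s₁ + 3*s₁^2)) :
    q₁ * (2*q₁ + r₁) * s₁^2 * (q₁^3 - q₁*s₁ - r₁*s₁)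
    * (2*q₁^4 + q₁^3*r₁ - 11*q₁^2*s₁ - 22*q₁*r₁*s₁ - 8*r₁^2*s₁ + 9*s₁^2)
    * (2*q₁^4 - 27*q₁^2*s₁ - 27*q₁*r₁*s₁ + 81*s₁^2)
    * (q₁^6 - 20*q₁^4*s₁ - 9*q₁^3*r₁*s₁ + 98*q₁^2*s₁^2 + 62*q₁*r₁*s₁^2
        + 8*r₁^2*s₁^2 + 9*s₁^3) = 0 := by
  by_cases hq : q₁ = 0
  · rw [hq]; ring
  have hC : C = -32 * r₁^2 * s₁^4 := by linear_combination 32 * h3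
  have hP : (5/2*A)^2 = (q₁^4 + 54*q₁^2*s₁ + 24*q₁*r₁*s₁ + 9*s₁^2) := by linear_combination 9 * h1
  have hB : 27 * (5/8*B) = (q₁^6 - 135*q₁^4*s₁ - 72*q₁^3*r₁*s₁ - 405*q₁^2*s₁^2 - 243*q₁*r₁*s₁^2 - 27*r₁^2*s₁^2) + (5/2*A) * (q₁^4 + 54*q₁^2*s₁ + 24*q₁*r₁*s₁ + 9*s₁^2) := by
    rw [← hP]; linear_combination 27 * h2
  have hUV : ((q₁^6 - 135*q₁^4*s₁ - 72*q₁^3*r₁*s₁ - 405*q₁^2*s₁^2 - 243*q₁*r₁*s₁^2 - 27*r₁^2*s₁^2)^2 + (q₁^4 + 54*q₁^2*s₁ + 24*q₁*r₁*s₁ + 9*s₁^2)^3 - 243*(s₁^4 * (q₁^2*r₁^2 + 6*q₁*r₁^3 + 3*r₁^4 + 6*q₁*r₁*s₁ + 3*s₁^2))) + (2*(q₁^6 - 135*q₁^4*s₁ - 72*q₁^3*r₁*s₁ - 405*q₁^2*s₁^2 - 243*q₁*r₁*s₁^2 - 27*r₁^2*s₁^2)*(q₁^4 + 54*q₁^2*s₁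 + 24*q₁*r₁*s₁ + 9*s₁^2) + 486*r₁^2*s₁^4) * (5/2*A) = 0 := by
    rw [hC] at h4
    generalize (q₁^4 + 54*q₁^2*s₁ + 24*q₁*r₁*s₁ + 9*s₁^2) = P at *
    generalize (q₁^6 - 135*q₁^4*s₁ - 72*q₁^3*r₁*s₁ - 405*q₁^2*s₁^2 - 243*q₁*r₁*s₁^2 - 27*r₁^2*s₁^2) = Q at *
    linear_combination 729 * h4 - (27*(5/8*B) + Q + 5/2*A*P) * hB - P^2 * hP
  have key : ((q₁^6 - 135*q₁^4*s₁ - 72*q₁^3*r₁*s₁ - 405*q₁^2*s₁^2 - 243*q₁*r₁*s₁^2 - 27*r₁^2*s₁^2)^2 + (q₁^4 + 54*q₁^2*s₁ + 24*q₁*r₁*s₁ + 9*s₁^2)^3 - 243*(s₁^4 * (q₁^2*r₁^2 + 6*q₁*r₁^3 + 3*r₁^4 + 6*q₁*r₁*s₁ + 3*s₁^2)))^2 - (2*(q₁^6 - 135*q₁^4*s₁ - 72*q₁^3*r₁*s₁ - 405*q₁^2*s₁^2 - 243*q₁*r₁*s₁^2 - 27*r₁^2*s₁^2)*(q₁^4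 + 54*q₁^2*s₁ + 24*q₁*r₁*s₁ + 9*s₁^2) + 486*r₁^2*s₁^4)^2 * (q₁^4 + 54*q₁^2*s₁ + 24*q₁*r₁*s₁ + 9*s₁^2) = 0 := by
    rw [← hP]
    rw [← hP] at hUV
    generalize (q₁^6 - 135*q₁^4*s₁ - 72*q₁^3*r₁*s₁ - 405*q₁^2*s₁^2 - 243*q₁*r₁*s₁^2 - 27*r₁^2*s₁^2) = Q at *
    linear_combination ((Q^2 + ((5/2*A)^2)^3 - 243*(s₁^4 * (q₁^2*r₁^2 + 6*q₁*r₁^3 + 3*r₁^4 + 6*q₁*r₁*s₁ + 3*s₁^2))) - (2*Q*(5/2*A)^2 + 486*r₁^2*s₁^4) * (5/2*A)) * hUV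
  have hc : (23328 * q₁ : ℂ) ≠ 0 := mul_ne_zero (by norm_num) hq
  refine (mul_eq_zero.mp ?_).resolve_left hc
  rw [← key]
  ring
end

section
/- For all complex numbers A and B, the identity 38400000000000·A⁹B² + 120528000000000·A⁶B³ − 4100625000000·A³B⁴ − 184528125000000·B⁵ = −184528125000000 · B² · (B − (25/27)·A³) · (B + (64/135)·A³)² holds. Consequently, the curve L₁ in P(1:3:5) intersects the divisor {C = 0} exactly in the three points (A:B:C) = (1:0:0), (1:25/27:0), and (1:−64/135:0). -/
/-- The defining polynomial of the curve L₁ in P(1:3:5). -/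
noncomputable def L₁poly (A B C : ℂ) : ℂ :=
  38400000000000*A^9*B^2 + 120528000000000*A^6*B^3
    - 4100625000000*A^3*B^4 - 184528125000000*B^5
    + 2560000000000*A^10*C + 6998400000000*A^7*B*C
    + 34698942000000*A^4*B^2*C + 42539883750000*A*B^3*C
    + 2576431800000*A^5*C^2 + 2714325066000*A^2*B*C^2
    + 146211169851*C^3

/-- The restriction of the defining polynomial of L₁ to {C = 0} factors as
−184528125000000·B²·(B − (25/27)A³)·(B + (64/135)A³)²; consequently L₁ meets
the divisor {C = 0} exactly in the three points (1:0:0), (1:25/27:0) and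
(1:−64/135:0) of P(1:3:5). -/
theorem L1_meets_C_eq_zero :
    (∀ A B : ℂ,
      38400000000000*A^9*B^2 + 120528000000000*A^6*B^3
        - 4100625000000*A^3*B^4 - 184528125000000*B^5
      = -184528125000000 * B^2 * (B - (25/27)*A^3) * (B + (64/135)*A^3)^2)
    ∧ (∀ A B : ℂ, (A, B) ≠ (0, 0) →
        (L₁poly A B 0 = 0 ↔
          A ≠ 0 ∧ (B = 0 ∨ B = (25/27)*A^3 ∨ B = -(64/135)*A^3))) := by
  have key : ∀ A B : ℂ,
      38400000000000*A^9*B^2 + 120528000000000*A^6*B^3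
        - 4100625000000*A^3*B^4 - 184528125000000*B^5
      = -184528125000000 * B^2 * (B - (25/27)*A^3) * (B + (64/135)*A^3)^2 := by
    intro A B
    ring
  refine ⟨key, ?_⟩
  intro A B hAB
  have h0 : L₁poly A B 0
      = -184528125000000 * B^2 * (B - (25/27)*A^3) * (B + (64/135)*A^3)^2 := by
    rw [← key, L₁poly]
    ring
  rw [h0]
  constructor
  · intro h
    have h3 : B = 0 ∨ B = (25/27)*A^3 ∨ B = -(64/135)*A^3 := by
      rcases mul_eq_zero.mp h with h | h
      · rcases mul_eq_zero.mp h with h | h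
        · rcases mul_eq_zero.mp h with h | h
          · norm_num at h
          · exact Or.inl (pow_eq_zero_iff (two_ne_zero) |>.mp h)
        · exact Or.inr (Or.inl (sub_eq_zero.mp h))
      · have h' := pow_eq_zero_iff (two_ne_zero) |>.mp h
        exact Or.inr (Or.inr (by linear_combination h'))
    refine ⟨?_, h3⟩
    rintro rfl
    apply hAB
    have hB : B = 0 := by
      rcases h3 with h | h | h
      · exact h
      · rw [h]; ring
      · rw [h]; ring
    rw [hB]
  · rintro ⟨-, h | h | h⟩ <;> rw [h] <;> ring
end

section
/- Let w be a nonzero complex number such that d(w) = −1 + √2 + 8w + 6(1+√2)w² ≠ 0. Define the symmetric 2×2 complex matrices Ω̌₆(w) = [[3w/2 − 1/(4w), −3√2·w/4 − 1/2 − √2/(8w)], [−3√2·w/4 − 1/2 − √2/(8w), 3w/4 − 1/2 − 1/(8w)]] and Ω̃₆(w) = (1/d(w))·[[−2 + √2 + 4w + 6(2+√2)w², √2 + 4w + 6√2·w²], [√2 + 4w + 6√2·w², −2 + 12w²]], and the 2×2 matrices A = [[−1,0],[0,0]] and B = I₂. Then A·Ω̌₆(w) + B = −Ω̃₆(w)·Ω̌₆(w).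 (Equivalently, with C = −I₂ and D = 0, when Ω̌₆(w) is invertible one has Ω̃₆(w) = (A·Ω̌₆(w) + B)·(C·Ω̌₆(w) + D)⁻¹.) -/
open Complex Matrix

/-- The modular embedding Ω̃₆ is obtained from the Hashimoto–Murabayashi
embedding Ω̌₆ by the symplectic action of M = [[A,B],[C,D]] with
A = [[−1,0],[0,0]], B = I₂, C = −I₂, D = 0:
A·Ω̌₆(w) + B = −Ω̃₆(w)·Ω̌₆(w). -/
theorem Omega6_symplectic_action (w : ℂ) (hw : w ≠ 0)
    (d : ℂ)
    (hdef : d = -1 + (Real.sqrt 2 : ℂ) + 8 * w + 6 * (1 + (Real.sqrt 2 : ℂ)) * w^2)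
    (hd : d ≠ 0)
    (Ωcheck Ωtilde A B : Matrix (Fin 2) (Fin 2) ℂ)
    (hΩcheck : Ωcheck =
      !![3 * w / 2 - 1 / (4 * w),
          -3 * (Real.sqrt 2 : ℂ) * w / 4 - 1/2 - (Real.sqrt 2 : ℂ) / (8 * w);
          -3 * (Real.sqrt 2 : ℂ) * w / 4 - 1/2 - (Real.sqrt 2 : ℂ) / (8 * w),
          3 * w / 4 - 1/2 - 1 / (8 * w)])
    (hΩtilde : Ωtilde = (1 / d) •
      !![(-2 : ℂ) + (Real.sqrt 2 : ℂ) + 4 * w + 6 * (2 + (Real.sqrt 2 : ℂ)) * w^2,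
          (Real.sqrt 2 : ℂ) + 4 * w + 6 * (Real.sqrt 2 : ℂ) * w^2;
          (Real.sqrt 2 : ℂ) + 4 * w + 6 * (Real.sqrt 2 : ℂ) * w^2,
          -2 + 12 * w^2])
    (hA : A = !![(-1 : ℂ), 0; 0, 0])
    (hB : B = 1) :
    A * Ωcheck + B = -(Ωtilde * Ωcheck) := by
  have hs : (Real.sqrt 2 : ℂ) ^ 2 = 2 := by
    rw [← Complex.ofReal_pow, Real.sq_sqrt (by norm_num)]; norm_num
  subst hΩcheck hΩtilde hA hB
  generalize (Real.sqrt 2 : ℂ) = s at *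
  ext i j
  fin_cases i <;> fin_cases j <;>
    simp [Matrix.mul_apply, Fin.sum_univ_two] <;> field_simp <;> subst hdef <;> grind
end

section
/- For all integers m and n, 53·m² + 1320·m·n + 8220·n² ≠ 21. (The integer 21 is not represented by the quadratic form Δ₁₅(m,n) attached to the quaternion algebra of discriminant 15.) -/
/-- The integer 21 is not represented by the quadratic form
Δ₁₅(m,n) = 53m² + 1320mn + 8220n² attached to the quaternion algebra of
discriminant 15. -/
theorem disc15_form_does_not_represent_21 (m n : ℤ) :
    53 * m^2 + 1320 * m * n + 8220 * n^2 ≠ 21 := by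
  intro h
  have h5 : ((53 * m^2 + 1320 * m * n + 8220 * n^2 : ℤ) : ZMod 5) = ((21 : ℤ) : ZMod 5) := by
    rw [h]
  push_cast at h5
  have key : ∀ x y : ZMod 5, 53 * x^2 + 1320 * x * y + 8220 * y^2 ≠ 21 := by decide
  exact key _ _ h5
end
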